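/- Let p ≥ 1 be an integer, let R be a commutative ℂ-algebra, and let ν = e^{2πi/p} ∈ ℂ ⊆ R. Let θ ∈ R be nilpotent, let x ∈ R be nilpotent, write e^{−x} = exp(−x), set m(z) = Σ_{i=0}^{p−1} z^i and q(z) = −z·m'(z)/m(z), and let A and n₁,…,n_{p−1} be integers. Then each element ν^j − e^{−x} (1 ≤ j ≤ p−1) and m(e^{−x}) is a unit of R, q(e^{−x}) := −e^{−x}·m'(e^{−x})·m(e^{−x})⁻¹ is defined, and Π_{j=1}^{p−1} [ (1 − ν^{−j})^{A} · (1 − e^{−x}ν^{−j})^{−A} · exp(θ e^{−x} (ν^{j} − e^{−x})⁻¹) · ((1 − e^{−x}ν^{−j})·(1 − ν^{−j})⁻¹)^{−n_j} ] = p^{A} · m(e^{−x})^{−A} · exp(θ·q(e^{−x})) · Π_{j=1}^{p−1} ((1 − e^{−x}ν^{−j})·(1 − ν^{−j})⁻¹)^{−n_j}, where integer powers of units are taken in the group of units of R and exp of nilpotent elements is the finite sum Σ_{m≥0} a^m/m!. -/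

import Mathlib

/-- Integer power of a ring element: `a^n` for `n ≥ 0`, and `Ring.inverse (a^(−n))`
for `n < 0` (agreeing with the power in the group of units when `a` is a unit). -/
noncomputable def zintPow {R : Type*} [CommRing R] (a : R) (n : ℤ) : R :=
  if 0 ≤ n then a ^ n.toNat else Ring.inverse (a ^ (-n).toNat)

open Polynomial in
/-- The geometric sum polynomial splits over the nontrivial powers of a primitive root of unity. -/
theorem IsPrimitiveRoot.geom_sum_X_eq_prod {K : Type*} [CommRing K] [IsDomain K] {p : ℕ}
    (hp : 1 ≤ p) {ν : K} (hν : IsPrimitiveRoot ν p) :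
    ∑ i ∈ Finset.range p, (X : K[X]) ^ i = ∏ j ∈ Finset.Ico 1 p, (X - C (ν ^ j)) := by
  have h := X_pow_sub_C_eq_prod hν hp (one_pow p)
  simp only [mul_one, map_one] at h
  rw [Finset.range_eq_Ico, Finset.prod_eq_prod_Ico_succ_bot (by lia), pow_zero, C_1,
    ← mul_geom_sum, zero_add] at h
  exact mul_left_cancel₀ (X_sub_C_ne_zero (1 : K)) (by rwa [C_1])

open Polynomial in
/-- The reciprocal form of `IsPrimitiveRoot.geom_sum_X_eq_prod`. -/
theorem IsPrimitiveRoot.geom_sum_X_eq_prod_one_sub {K : Type*} [Field K] {p : ℕ}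
    (hp : 1 ≤ p) {ν : K} (hν : IsPrimitiveRoot ν p) :
    ∑ i ∈ Finset.range p, (X : K[X]) ^ i =
      ∏ j ∈ Finset.Ico 1 p, (1 - X * C (ν ^ (-(j : ℤ)))) := by
  have hν0 : ν ≠ 0 := hν.ne_zero (by lia)
  have hfac (j : ℕ) : X - C (ν ^ j) = C (-ν ^ j) * (1 - X * C (ν ^ (-(j : ℤ)))) := by
    have : C (ν ^ j) * C (ν ^ (-(j : ℤ))) = 1 := by
      rw [← C_mul, zpow_neg, zpow_natCast, mul_inv_cancel₀ (pow_ne_zero j hν0), C_1]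
    rw [C_neg]
    linear_combination -X * this
  have h := hν.geom_sum_X_eq_prod hp
  have hconst : ∏ j ∈ Finset.Ico 1 p, (-ν ^ j) = 1 := by
    have h0 := congrArg (eval 0) h
    obtain ⟨k, rfl⟩ : ∃ k, p = k + 1 := ⟨p - 1, by lia⟩
    simpa [eval_finsetSum, eval_prod, Finset.sum_range_succ'] using h0.symm
  rw [h, Finset.prod_congr rfl fun j _ ↦ hfac j, Finset.prod_mul_distrib, ← map_prod, hconst,
    C_1, one_mul]

open Polynomial in
/-- Logarithmic derivative of a product of linear factors at a point where they are units. -/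
theorem Polynomial.aeval_derivative_prod_X_sub_C {ι K R : Type*} [CommRing K] [CommRing R]
    [Algebra K R] (s : Finset ι) (a : ι → K) (z : R)
    (hu : ∀ i ∈ s, IsUnit (z - algebraMap K R (a i))) :
    aeval z (derivative (∏ i ∈ s, (X - C (a i)))) =
      aeval z (∏ i ∈ s, (X - C (a i))) * ∑ i ∈ s, Ring.inverse (z - algebraMap K R (a i)) := by
  classical
  induction s using Finset.induction_on with
  | empty => simp
  | insert i s hi ih =>
    have hc := Ring.mul_inverse_cancel _ (hu i (Finset.mem_insert_self i s))
    have ih' := ih fun j hj ↦ hu j (Finset.mem_insert_of_mem hj)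
    rw [Finset.prod_insert hi, Finset.sum_insert hi]
    rw [derivative_mul, derivative_X_sub_C, one_mul]
    simp only [map_add, map_mul, map_sub, aeval_X, aeval_C, ih']
    linear_combination -(aeval z (∏ i ∈ s, (X - C (a i)))) * hc

theorem Ring.inverse_neg {R : Type*} [CommRing R] (a : R) :
    Ring.inverse (-a) = -Ring.inverse a := by
  by_cases h : IsUnit a
  · have h1 := Ring.mul_inverse_cancel _ h
    have h2 := Ring.inverse_mul_cancel _ h.neg
    linear_combination (-Ring.inverse (-a)) * h1 - Ring.inverse a * h2
  · rw [Ring.inverse_non_unit _ h, Ring.inverse_non_unit _ (by simpa using h), neg_zero]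

theorem zintPow_prod {ι R : Type*} [CommRing R] (s : Finset ι) (f : ι → R) (n : ℤ) :
    zintPow (∏ i ∈ s, f i) n = ∏ i ∈ s, zintPow (f i) n := by
  classical
  unfold zintPow
  split_ifs
  · exact (Finset.prod_pow _ _ _).symm
  · rw [← Finset.prod_pow]
    induction s using Finset.induction_on with
    | empty => simp
    | insert i s hi ih =>
      rw [Finset.prod_insert hi, Finset.prod_insert hi, Ring.mul_inverse_rev, ih, mul_comm]

theorem IsNilpotent.exp_sum {ι R : Type*} [CommRing R] [Module ℚ R] (s : Finset ι) (f : ι → R)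
    (hf : ∀ i ∈ s, IsNilpotent (f i)) :
    IsNilpotent.exp (∑ i ∈ s, f i) = ∏ i ∈ s, IsNilpotent.exp (f i) := by
  classical
  induction s using Finset.induction_on with
  | empty => simp
  | insert i s hi ih =>
    rw [Finset.forall_mem_insert] at hf
    rw [Finset.sum_insert hi, Finset.prod_insert hi, ← ih hf.2]
    exact IsNilpotent.exp_add_of_commute (Commute.all _ _) hf.1 (isNilpotent_sum hf.2)

theorem IsNilpotent.exp_eq_sum_algebraMap {R : Type*} [CommRing R] [Algebra ℂ R] [Algebra ℚ R]
    {a : R} {k : ℕ} (h : a ^ k = 0) :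
    IsNilpotent.exp a =
      ∑ m ∈ Finset.range k, algebraMap ℂ R ((m.factorial : ℂ)⁻¹) * a ^ m := by
  rw [IsNilpotent.exp_eq_sum h]
  refine Finset.sum_congr rfl fun i _ ↦ ?_
  have : algebraMap ℂ R ((i.factorial : ℂ)⁻¹) = algebraMap ℚ R ((i.factorial : ℚ)⁻¹) := by
    have hq := RingHom.congr_fun
      (Subsingleton.elim ((algebraMap ℂ R).comp (algebraMap ℚ ℂ)) (algebraMap ℚ R))
      ((i.factorial : ℚ)⁻¹)
    simpa using hq
  rw [this, Algebra.smul_def]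

/-- Theorem 5.1(d) of the paper: with `ν = e^{2πi/p}`, `θ`, `x` nilpotent,
`e^{−x}` the finite exponential sum, `m(z) = Σ_{i<p} z^i` and
`q(z) = −z·m'(z)/m(z)`, the elements `ν^j − e^{−x}` (for `1 ≤ j ≤ p−1`) and
`m(e^{−x})` are units, and
`Π_{j=1}^{p−1} [(1−ν^{−j})^A·(1−e^{−x}ν^{−j})^{−A}·exp(θe^{−x}(ν^j−e^{−x})⁻¹)·((1−e^{−x}ν^{−j})/(1−ν^{−j}))^{−n_j}]
 = p^A·m(e^{−x})^{−A}·exp(θ·q(e^{−x}))·Π_{j=1}^{p−1} ((1−e^{−x}ν^{−j})/(1−ν^{−j}))^{−n_j}`. -/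
theorem stmt12 (p : ℕ) (hp : 1 ≤ p) (R : Type*) [CommRing R] [Algebra ℂ R]
    (ν : ℂ) (hν : ν = Complex.exp (2 * (Real.pi : ℂ) * Complex.I / p))
    (θ x : R) (Nθ Nx : ℕ) (hθn : θ ^ Nθ = 0) (hxn : x ^ Nx = 0)
    (ex : R)
    (hex : ex = ∑ m ∈ Finset.range Nx, algebraMap ℂ R ((m.factorial : ℂ)⁻¹) * (-x) ^ m)
    (E : R → R)
    (hE : ∀ a : R, E a = ∑ m ∈ Finset.range Nθ, algebraMap ℂ R ((m.factorial : ℂ)⁻¹) * a ^ m)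
    (m : Polynomial ℂ) (hm : m = ∑ i ∈ Finset.range p, Polynomial.X ^ i)
    (A : ℤ) (nj : ℕ → ℤ) :
    (∀ j ∈ Finset.Ico 1 p, IsUnit (algebraMap ℂ R (ν ^ j) - ex)) ∧
    IsUnit (Polynomial.aeval ex m) ∧
    ∏ j ∈ Finset.Ico 1 p,
      (algebraMap ℂ R ((1 - ν ^ (-(j : ℤ))) ^ A)
        * zintPow (1 - ex * algebraMap ℂ R (ν ^ (-(j : ℤ)))) (-A)
        * E (θ * ex * Ring.inverse (algebraMap ℂ R (ν ^ j) - ex))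
        * zintPow ((1 - ex * algebraMap ℂ R (ν ^ (-(j : ℤ))))
            * algebraMap ℂ R ((1 - ν ^ (-(j : ℤ)))⁻¹)) (-(nj j)))
    = algebraMap ℂ R ((p : ℂ) ^ A)
      * zintPow (Polynomial.aeval ex m) (-A)
      * E (θ * (-ex * Polynomial.aeval ex (Polynomial.derivative m)
            * Ring.inverse (Polynomial.aeval ex m)))
      * ∏ j ∈ Finset.Ico 1 p,
          zintPow ((1 - ex * algebraMap ℂ R (ν ^ (-(j : ℤ))))
            * algebraMap ℂ R ((1 - ν ^ (-(j : ℤ)))⁻¹)) (-(nj j)) := by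
  let _ : Algebra ℚ R := Algebra.compHom R (algebraMap ℚ ℂ)
  have hprim : IsPrimitiveRoot ν p := hν ▸ Complex.isPrimitiveRoot_exp p (by lia)
  have hexn : IsNilpotent (ex - 1) := by
    have hx : (-x) ^ Nx = 0 := by rw [neg_pow, hxn, mul_zero]
    rw [hex, ← IsNilpotent.exp_eq_sum_algebraMap hx]
    exact IsNilpotent.isNilpotent_exp_sub_one ⟨Nx, hx⟩
  have hE' (c : R) : E (θ * c) = IsNilpotent.exp (θ * c) := by
    rw [hE, IsNilpotent.exp_eq_sum_algebraMap (by rw [mul_pow, hθn, zero_mul])]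
  have hnil (c : R) : IsNilpotent (θ * c) := ⟨Nθ, by rw [mul_pow, hθn, zero_mul]⟩
  have hunit : ∀ j ∈ Finset.Ico 1 p, IsUnit (algebraMap ℂ R (ν ^ j) - ex) := by
    intro j hj
    rw [Finset.mem_Ico] at hj
    have h1 : ν ^ j - 1 ≠ 0 := sub_ne_zero.2 (hprim.pow_ne_one_of_pos_of_lt (by lia) hj.2)
    have h2 : IsUnit (algebraMap ℂ R (ν ^ j - 1)) := h1.isUnit.map _
    have h3 := IsNilpotent.isUnit_add_left_of_commute hexn.neg h2 (Commute.all _ _)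
    convert h3 using 1
    rw [map_sub, map_one]
    ring
  have hunit' : ∀ j ∈ Finset.Ico 1 p, IsUnit (ex - algebraMap ℂ R (ν ^ j)) := fun j hj ↦ by
    simpa using (hunit j hj).neg
  have hm1 := hm.trans (hprim.geom_sum_X_eq_prod hp)
  have hm2 := hm.trans (hprim.geom_sum_X_eq_prod_one_sub hp)
  have hmu : IsUnit (Polynomial.aeval ex m) := by
    rw [hm1, map_prod]
    refine IsUnit.prod_iff.2 fun j hj ↦ ?_
    simpa using hunit' j hj
  have hprod : Polynomial.aeval ex m =
      ∏ j ∈ Finset.Ico 1 p, (1 - ex * algebraMap ℂ R (ν ^ (-(j : ℤ)))) := by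
    rw [hm2, map_prod]
    simp only [map_sub, map_one, map_mul, Polynomial.aeval_X, Polynomial.aeval_C]
  have hpprod : (p : ℂ) = ∏ j ∈ Finset.Ico 1 p, (1 - ν ^ (-(j : ℤ))) := by
    have h := congrArg (Polynomial.eval 1) (hprim.geom_sum_X_eq_prod_one_sub hp)
    simpa [Polynomial.eval_finsetSum, Polynomial.eval_prod] using h
  have hq : -ex * Polynomial.aeval ex (Polynomial.derivative m) *
        Ring.inverse (Polynomial.aeval ex m) =
      ∑ j ∈ Finset.Ico 1 p, ex * Ring.inverse (algebraMap ℂ R (ν ^ j) - ex) := by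
    have hd := Polynomial.aeval_derivative_prod_X_sub_C (Finset.Ico 1 p) (ν ^ ·) ex hunit'
    have hc := Ring.mul_inverse_cancel _ hmu
    simp only [← hm1, ← neg_sub (algebraMap ℂ R _) ex, Ring.inverse_neg,
      Finset.sum_neg_distrib] at hd
    rw [hd, ← Finset.mul_sum]
    linear_combination ex *
      (∑ j ∈ Finset.Ico 1 p, Ring.inverse (algebraMap ℂ R (ν ^ j) - ex)) * hc
  refine ⟨hunit, hmu, ?_⟩
  simp only [mul_assoc θ, hE']
  rw [hq, Finset.mul_sum, IsNilpotent.exp_sum _ _ fun j _ ↦ hnil _, hprod, zintPow_prod, hpprod,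
    ← Finset.prod_zpow, map_prod]
  simp only [Finset.prod_mul_distrib]
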